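/- arXiv:1102.0534 — 3 statements merged into one kernel-verified Lean document; each statement's English description precedes it below -/
import Mathlib

section
/- Let k ≤ n be positive integers. Let Q be a random n × k real matrix distributed according to the Haar probability measure on the Stiefel manifold V_k^n, and let Γ be an n × k random matrix with independent N(0,1) entries. Define α = α(k, n) = (1/k) Σ_{i=1}^k E(X_i), where X_i is the positive square root of a chi-square random variable with n − i + 1 degrees of freedom. Then for every convex function f : M^{n×k} → ℝ, one has E f(Q) ≤ E f(α^{-1} Γ). -/
open MeasureTheory ProbabilityTheory Matrix

/-- The space of `n × k` real matrices carries the product measurable structure. -/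
instance matrixMeasurableSpace (n k : ℕ) : MeasurableSpace (Matrix (Fin n) (Fin k) ℝ) :=
  MeasurableSpace.pi

/-- The expectation of the positive square root of a chi-square random variable with `p`
degrees of freedom; chi-square with `p` degrees of freedom is the Gamma distribution with
shape `p/2` and rate `1/2`. -/
noncomputable def chiSqrtMoment (p : ℝ) : ℝ :=
  ∫ x, Real.sqrt x ∂(gammaMeasure (p / 2) (1 / 2))

/-- The constant `α(k, n) = (1/k) Σ_{i=1}^k E(X_i)` where `X_i²` is chi-square with
`n - i + 1` degrees of freedom. -/
noncomputable def alphaConst (k n : ℕ) : ℝ :=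
  (1 / (k : ℝ)) * ∑ i ∈ Finset.Icc 1 k, chiSqrtMoment ((n : ℝ) - (i : ℝ) + 1)

lemma chiSqrtMoment_eq {p : ℝ} (hp : 0 < p) :
    chiSqrtMoment p = √2 * Real.Gamma ((p + 1) / 2) / Real.Gamma (p / 2) := by
  have hΓ : Real.Gamma (p / 2) ≠ 0 := (Real.Gamma_pos_of_pos (by positivity)).ne'
  rw [chiSqrtMoment, gammaMeasure, integral_withDensity_eq_integral_toReal_smul
    (f := gammaPDF (p / 2) (1 / 2)) (by unfold gammaPDF; fun_prop) (by simp [gammaPDF])]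
  have h1 : ∀ x : ℝ, (gammaPDF (p / 2) (1 / 2) x).toReal • √x = (Set.Ioi (0 : ℝ)).indicator
      (fun x => (1 / 2 : ℝ) ^ (p / 2) / Real.Gamma (p / 2) *
        (x ^ ((p + 1) / 2 - 1) * Real.exp (-((1 / 2) * x)))) x := by
    intro x
    rw [gammaPDF, ENNReal.toReal_ofReal (gammaPDFReal_nonneg (by positivity) (by norm_num) x)]
    by_cases hx : 0 < x
    · rw [Set.indicator_of_mem (by exact hx), gammaPDFReal, if_pos hx.le, smul_eq_mul,
        Real.sqrt_eq_rpow, show (p + 1) / 2 - 1 = (p / 2 - 1) + 1 / 2 by ring, Real.rpow_add hx]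
      ring
    · rw [Set.indicator_of_notMem (by simpa using hx), Real.sqrt_eq_zero_of_nonpos (not_lt.1 hx),
        smul_zero]
  simp_rw [h1]
  rw [integral_indicator measurableSet_Ioi, integral_const_mul,
    Real.integral_rpow_mul_exp_neg_mul_Ioi (by positivity) (by norm_num)]
  rw [Real.sqrt_eq_rpow, show (p + 1) / 2 = p / 2 + 1 / 2 by ring, one_div_one_div,
    Real.rpow_add (by norm_num), Real.div_rpow (by norm_num) (by norm_num), Real.one_rpow]
  have h2 : (2 : ℝ) ^ (p / 2) ≠ 0 := by positivity
  field_simp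

lemma chiSqrtMoment_pos {p : ℝ} (hp : 0 < p) : 0 < chiSqrtMoment p := by
  rw [chiSqrtMoment_eq hp]
  have := Real.Gamma_pos_of_pos (show 0 < p / 2 by positivity)
  have := Real.Gamma_pos_of_pos (show 0 < (p + 1) / 2 by positivity)
  positivity

section StdGaussian

variable {E : Type*} [NormedAddCommGroup E] [InnerProductSpace ℝ E] [FiniteDimensional ℝ E]
  [MeasurableSpace E] [BorelSpace E]

lemma stdGaussian_eq_withDensity : stdGaussian E = volume.withDensity (fun x => ENNReal.ofReal
    ((2 * Real.pi) ^ (-(Module.finrank ℝ E : ℝ) / 2) * Real.exp (-(1 / 2) * ‖x‖ ^ 2))) := by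
  set c : ℝ := (2 * Real.pi) ^ (-(Module.finrank ℝ E : ℝ) / 2) with hc
  have hc0 : 0 ≤ c := by positivity
  have hint : Integrable (fun x : E => c * Real.exp (-(1 / 2) * ‖x‖ ^ 2)) := by
    refine Integrable.const_mul ?_ c
    have h := (GaussianFourier.integrable_cexp_neg_mul_sq_norm_add (V := E)
      (b := ((1 / 2 : ℝ) : ℂ)) (by norm_num) 0 0).norm
    refine h.congr (Filter.Eventually.of_forall fun x => ?_)
    simp [Complex.norm_exp, ← Complex.ofReal_pow]
  have hfin : IsFiniteMeasure (volume.withDensity (fun x : E => ENNReal.ofReal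
      (c * Real.exp (-(1 / 2) * ‖x‖ ^ 2)))) :=
    isFiniteMeasure_withDensity_ofReal hint.2
  refine Measure.ext_of_charFun ?_
  ext t
  rw [charFun_stdGaussian, charFun_apply,
    integral_withDensity_eq_integral_toReal_smul (by fun_prop) (by simp)]
  have h := GaussianFourier.integral_cexp_neg_mul_sq_norm_add (V := E)
    (b := ((1 / 2 : ℝ) : ℂ)) (by norm_num) Complex.I t
  have h2 : ∀ x : E, (ENNReal.ofReal (c * Real.exp (-(1 / 2) * ‖x‖ ^ 2))).toReal •
      Complex.exp (((inner ℝ x t : ℝ) : ℂ) * Complex.I) = (c : ℂ) *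
      Complex.exp (-((1 / 2 : ℝ) : ℂ) * ‖x‖ ^ 2 + Complex.I * ((inner ℝ t x : ℝ) : ℂ)) := by
    intro x
    rw [ENNReal.toReal_ofReal (by positivity), Complex.real_smul, Complex.exp_add,
      real_inner_comm, mul_comm Complex.I]
    push_cast
    ring
  simp_rw [h2]
  rw [integral_const_mul, h, ← mul_assoc]
  have h3 : (c : ℂ) * (Real.pi / ((1 / 2 : ℝ) : ℂ)) ^ ((Module.finrank ℝ E : ℂ) / 2) = 1 := by
    have : (Real.pi / ((1 / 2 : ℝ) : ℂ)) ^ ((Module.finrank ℝ E : ℂ) / 2) =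
        (((2 * Real.pi) ^ ((Module.finrank ℝ E : ℝ) / 2) : ℝ) : ℂ) := by
      rw [Complex.ofReal_cpow (by positivity)]
      push_cast
      congr 1
      ring
    rw [this, ← Complex.ofReal_mul, hc, ← Real.rpow_add (by positivity), neg_div,
      neg_add_cancel, Real.rpow_zero, Complex.ofReal_one]
  rw [h3, one_mul, Complex.I_sq]
  congr 1
  push_cast
  ring

lemma integral_norm_stdGaussian (hE : 0 < Module.finrank ℝ E) :
    ∫ x, ‖x‖ ∂(stdGaussian E) = chiSqrtMoment (Module.finrank ℝ E) := by
  have : Nontrivial E := Module.nontrivial_of_finrank_pos hE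
  set d := Module.finrank ℝ E with hd
  have hd0 : (0 : ℝ) < d := by exact_mod_cast hE
  have key : ∀ q : ℕ, ∫ x, ‖x‖ ^ q ∂(stdGaussian E) =
      (2 * Real.pi) ^ (-(d : ℝ) / 2) * (d * (volume : Measure E).real (Metric.ball 0 1)) *
        ((1 / 2 : ℝ) ^ (-((d + q : ℝ)) / 2) * (1 / 2) * Real.Gamma ((d + q) / 2)) := by
    intro q
    rw [stdGaussian_eq_withDensity,
      integral_withDensity_eq_integral_toReal_smul (by fun_prop) (by simp)]
    have h := integral_fun_norm_addHaar (volume : Measure E)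
      (fun r => (2 * Real.pi) ^ (-(d : ℝ) / 2) * Real.exp (-(1 / 2) * r ^ 2) * r ^ q)
    have h1 : ∀ x : E, (ENNReal.ofReal ((2 * Real.pi) ^ (-(d : ℝ) / 2) *
        Real.exp (-(1 / 2) * ‖x‖ ^ 2))).toReal • ‖x‖ ^ q =
        (2 * Real.pi) ^ (-(d : ℝ) / 2) * Real.exp (-(1 / 2) * ‖x‖ ^ 2) * ‖x‖ ^ q := by
      intro x
      rw [ENNReal.toReal_ofReal (by positivity), smul_eq_mul]
    simp_rw [← hd, h1]
    rw [h, ← hd]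
    have h2 : ∫ y in Set.Ioi (0 : ℝ), y ^ (d - 1) •
        ((2 * Real.pi) ^ (-(d : ℝ) / 2) * Real.exp (-(1 / 2) * y ^ 2) * y ^ q) =
        ∫ y in Set.Ioi (0 : ℝ), (2 * Real.pi) ^ (-(d : ℝ) / 2) *
          (y ^ ((d + q - 1 : ℝ)) * Real.exp (-(1 / 2) * y ^ (2 : ℝ))) := by
      refine setIntegral_congr_fun measurableSet_Ioi fun y (hy : 0 < y) => ?_
      have h3 : y ^ ((d + q - 1 : ℝ)) = y ^ (d - 1) * y ^ q := by
        rw [← pow_add, ← Real.rpow_natCast]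
        congr 1
        have : 1 ≤ d := hE
        push_cast [Nat.cast_sub this]
        ring
      simp only [smul_eq_mul, h3, Real.rpow_two]
      ring
    rw [h2, integral_const_mul, integral_rpow_mul_exp_neg_mul_rpow (by norm_num) (by
      have : (0 : ℝ) ≤ q := by positivity
      linarith) (by norm_num)]
    simp only [nsmul_eq_mul, smul_eq_mul, sub_add_cancel]
    ring
  have h0 := key 0
  have h1 := key 1
  simp only [pow_zero, integral_const, probReal_univ, smul_eq_mul, mul_one, Nat.cast_zero,
    add_zero, pow_one, Nat.cast_one] at h0 h1
  have hΓ := Real.Gamma_pos_of_pos (show 0 < (d : ℝ) / 2 by positivity)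
  have h2 : (0 : ℝ) < (1 / 2) ^ (-(d : ℝ) / 2) := by positivity
  have h3 : (1 / 2 : ℝ) ^ (-((d : ℝ) + 1) / 2) = (1 / 2) ^ (-(d : ℝ) / 2) * √2 := by
    rw [show -((d : ℝ) + 1) / 2 = -(d : ℝ) / 2 + -(1 / 2) by ring, Real.rpow_add (by norm_num),
      Real.sqrt_eq_rpow, Real.rpow_neg (by norm_num), ← Real.inv_rpow (by norm_num)]
    norm_num
  rw [h1, h3, chiSqrtMoment_eq hd0]
  rw [eq_div_iff hΓ.ne']
  calc _ = ((2 * Real.pi) ^ (-(d : ℝ) / 2) * (d * (volume : Measure E).real (Metric.ball 0 1)) *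
        ((1 / 2 : ℝ) ^ (-((d : ℝ)) / 2) * (1 / 2) * Real.Gamma (d / 2))) *
          (√2 * Real.Gamma ((d + 1) / 2)) := by ring
    _ = _ := by rw [← h0, one_mul]

lemma stdGaussian_map_orthogonalProjectionOnto (W : Submodule ℝ E) :
    (stdGaussian E).map W.orthogonalProjectionOnto = stdGaussian W := by
  have : IsProbabilityMeasure ((stdGaussian E).map W.orthogonalProjectionOnto) :=
    Measure.isProbabilityMeasure_map (by fun_prop)
  refine Measure.ext_of_charFun ?_
  ext t
  rw [charFun_apply, integral_map (by fun_prop) (by fun_prop), charFun_stdGaussian]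
  simp_rw [Submodule.inner_orthogonalProjectionOnto_eq_of_mem_right]
  rw [← charFun_apply, charFun_stdGaussian, Submodule.coe_norm]

end StdGaussian

section GramSchmidt

variable {E : Type*} [NormedAddCommGroup E] [InnerProductSpace ℝ E]
variable {ι : Type*} [LinearOrder ι] [LocallyFiniteOrderBot ι] [WellFoundedLT ι]

lemma measurable_gramSchmidt [MeasurableSpace E] [BorelSpace E] [SecondCountableTopology E]
    {Ω : Type*} [MeasurableSpace Ω] {g : Ω → ι → E} (hg : ∀ i, Measurable fun ω => g ω i) (i : ι) :
    Measurable fun ω => InnerProductSpace.gramSchmidt ℝ (g ω) i := by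
  induction i using WellFoundedLT.induction with
  | ind i ih =>
    simp_rw [InnerProductSpace.gramSchmidt_def ℝ _ i, Submodule.starProjection_singleton]
    refine (hg i).sub (Finset.measurable_fun_sum _ fun j hj => ?_)
    have hm := ih j (Finset.mem_Iio.1 hj)
    have hi := hg i
    exact ((hm.inner hi).div (by simpa using hm.norm.pow_const 2)).smul hm

lemma sub_gramSchmidt_mem_span (g : ι → E) (i : ι) :
    g i - InnerProductSpace.gramSchmidt ℝ g i ∈ Submodule.span ℝ (g '' Set.Iio i) := by
  rw [InnerProductSpace.gramSchmidt_def, sub_sub_cancel, ← InnerProductSpace.span_gramSchmidt_Iio]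
  refine Submodule.sum_mem _ fun j hj => ?_
  rw [Submodule.starProjection_singleton]
  exact Submodule.smul_mem _ _ (Submodule.subset_span ⟨j, Finset.mem_Iio.1 hj, rfl⟩)

lemma inner_gramSchmidt_self (g : ι → E) (i : ι) :
    inner ℝ (InnerProductSpace.gramSchmidt ℝ g i) (g i) =
      ‖InnerProductSpace.gramSchmidt ℝ g i‖ ^ 2 := by
  have h := sub_gramSchmidt_mem_span g i
  rw [← InnerProductSpace.span_gramSchmidt_Iio] at h
  have h0 : inner ℝ (InnerProductSpace.gramSchmidt ℝ g i)
      (g i - InnerProductSpace.gramSchmidt ℝ g i) = 0 := by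
    refine Submodule.mem_orthogonal_singleton_iff_inner_right.1 (Submodule.span_le.2 ?_ h)
    rintro _ ⟨j, hj, rfl⟩
    exact Submodule.mem_orthogonal_singleton_iff_inner_right.2
      (InnerProductSpace.gramSchmidt_orthogonal ℝ g (ne_of_gt hj))
  rw [inner_sub_right, real_inner_self_eq_norm_sq, sub_eq_zero] at h0
  exact h0

lemma norm_gramSchmidt_le (g : ι → E) (i : ι) :
    ‖InnerProductSpace.gramSchmidt ℝ g i‖ ≤ ‖g i‖ := by
  have h := real_inner_le_norm (InnerProductSpace.gramSchmidt ℝ g i) (g i)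
  rw [inner_gramSchmidt_self] at h
  rcases (norm_nonneg (InnerProductSpace.gramSchmidt ℝ g i)).eq_or_lt with h0 | h0
  · rw [← h0]; exact norm_nonneg _
  · nlinarith

lemma inner_gramSchmidtOrthonormalBasis_self [Fintype ι] [FiniteDimensional ℝ E]
    (h : Module.finrank ℝ E = Fintype.card ι) (g : ι → E) (i : ι) :
    inner ℝ (InnerProductSpace.gramSchmidtOrthonormalBasis h g i) (g i) =
      ‖InnerProductSpace.gramSchmidt ℝ g i‖ := by
  by_cases hi : InnerProductSpace.gramSchmidtNormed ℝ g i = 0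
  · rw [InnerProductSpace.inner_gramSchmidtOrthonormalBasis_eq_zero h hi]
    have : InnerProductSpace.gramSchmidt ℝ g i = 0 := by
      simpa [InnerProductSpace.gramSchmidtNormed] using hi
    rw [this, norm_zero]
  · have h0 : ‖InnerProductSpace.gramSchmidt ℝ g i‖ ≠ 0 := by
      intro h0
      simp [InnerProductSpace.gramSchmidtNormed, norm_eq_zero.1 h0] at hi
    rw [InnerProductSpace.gramSchmidtOrthonormalBasis_apply h hi,
      InnerProductSpace.gramSchmidtNormed, real_inner_smul_left, inner_gramSchmidt_self]
    simp only [RCLike.ofReal_real_eq_id, id_eq]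
    field_simp

lemma norm_orthogonalProjectionOnto_le_norm_gramSchmidt (W : Submodule ℝ E)
    [W.HasOrthogonalProjection] (g : ι → E) (i : ι) (hW : ∀ j < i, g j ∈ Wᗮ) :
    ‖W.orthogonalProjectionOnto (g i)‖ ≤ ‖InnerProductSpace.gramSchmidt ℝ g i‖ := by
  have h : W.orthogonalProjectionOnto (g i - InnerProductSpace.gramSchmidt ℝ g i) = 0 := by
    rw [Submodule.orthogonalProjectionOnto_eq_zero_iff]
    refine Submodule.span_le.2 ?_ (sub_gramSchmidt_mem_span g i)
    rintro _ ⟨j, hj, rfl⟩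
    exact hW j hj
  rw [map_sub, sub_eq_zero] at h
  rw [h]
  exact W.norm_orthogonalProjectionOnto_apply_le _

lemma exists_submodule_finrank_eq [FiniteDimensional ℝ E] (V : Submodule ℝ E) {d : ℕ}
    (hd : d ≤ Module.finrank ℝ V) : ∃ W ≤ V, Module.finrank ℝ W = d := by
  let v : Fin d → E := fun j => stdOrthonormalBasis ℝ V (Fin.castLE hd j)
  have hv : LinearIndependent ℝ v :=
    ((stdOrthonormalBasis ℝ V).toBasis.linearIndependent.map' V.subtype V.ker_subtype).comp _
      (Fin.castLE_injective hd)
  refine ⟨Submodule.span ℝ (Set.range v), Submodule.span_le.2 ?_, ?_⟩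
  · rintro _ ⟨j, rfl⟩
    exact Subtype.property _
  · rw [finrank_span_eq_card hv, Fintype.card_fin]

lemma chiSqrtMoment_le_integral_norm_gramSchmidt_update [FiniteDimensional ℝ E]
    [MeasurableSpace E] [BorelSpace E] (g : ι → E) (i : ι)
    (hi : (Finset.Iio i).card < Module.finrank ℝ E) :
    chiSqrtMoment ((Module.finrank ℝ E - (Finset.Iio i).card : ℕ) : ℝ) ≤
      ∫ x, ‖InnerProductSpace.gramSchmidt ℝ (Function.update g i x) i‖ ∂(stdGaussian E) := by
  classical
  set V := Submodule.span ℝ (g '' Set.Iio i) with hV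
  have hVd : Module.finrank ℝ V ≤ (Finset.Iio i).card := by
    have h := finrank_span_finset_le_card (R := ℝ) ((Finset.Iio i).image g)
    rw [Finset.coe_image, Finset.coe_Iio] at h
    exact h.trans Finset.card_image_le
  obtain ⟨W, hWV, hW⟩ := exists_submodule_finrank_eq Vᗮ
    (d := Module.finrank ℝ E - (Finset.Iio i).card) (by
      have := V.finrank_add_finrank_orthogonal
      omega)
  have h1 := integral_norm_stdGaussian (E := W) (by omega)
  rw [hW, ← stdGaussian_map_orthogonalProjectionOnto,
    integral_map (by fun_prop) (by fun_prop)] at h1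
  rw [← h1]
  have hid : Integrable (fun x : E => ‖x‖) (stdGaussian E) := IsGaussian.integrable_id.norm
  refine integral_mono_of_nonneg (Filter.Eventually.of_forall fun _ => norm_nonneg _) ?_
    (Filter.Eventually.of_forall fun x => ?_)
  · refine hid.mono' ?_ (Filter.Eventually.of_forall fun x => ?_)
    · refine (measurable_gramSchmidt (fun j => ?_) i).norm.aestronglyMeasurable
      exact (measurable_pi_apply j).comp (measurable_update g)
    · rw [norm_norm]
      simpa using norm_gramSchmidt_le (Function.update g i x) i
  · have h := norm_orthogonalProjectionOnto_le_norm_gramSchmidt W (Function.update g i x) i (by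
      intro j hj
      rw [Function.update_of_ne hj.ne]
      exact Submodule.le_orthogonal_orthogonal V |>.trans (Submodule.orthogonal_le hWV)
        (Submodule.subset_span ⟨j, hj, rfl⟩))
    simpa using h

end GramSchmidt

section GaussianMatrix

/-- The law of an `n × k` matrix with independent standard Gaussian entries. -/
noncomputable def gaussianMatrix (n k : ℕ) : Measure (Matrix (Fin n) (Fin k) ℝ) :=
  Measure.pi fun _ : Fin n => Measure.pi fun _ : Fin k => gaussianReal 0 1

instance (n k : ℕ) : IsProbabilityMeasure (gaussianMatrix n k) := by
  unfold gaussianMatrix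
  exact Measure.pi.instIsProbabilityMeasure
    (fun _ : Fin n => Measure.pi fun _ : Fin k => gaussianReal 0 1)

instance (n k : ℕ) : BorelSpace (Matrix (Fin n) (Fin k) ℝ) :=
  inferInstanceAs (BorelSpace (Fin n → Fin k → ℝ))

/-- The identification of matrices with the Euclidean space of their entries. -/
noncomputable def matrixToEuclidean (n k : ℕ) :
    Matrix (Fin n) (Fin k) ℝ ≃ₗ[ℝ] EuclideanSpace ℝ (Fin n × Fin k) :=
  (LinearEquiv.curry ℝ ℝ (Fin n) (Fin k)).symm ≪≫ₗ (WithLp.linearEquiv 2 ℝ _).symm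

lemma matrixToEuclidean_apply {n k : ℕ} (M : Matrix (Fin n) (Fin k) ℝ) (p : Fin n × Fin k) :
    matrixToEuclidean n k M p = M p.1 p.2 := rfl

lemma measurable_entry {n k : ℕ} (i : Fin n) (j : Fin k) :
    Measurable fun M : Matrix (Fin n) (Fin k) ℝ => M i j :=
  (measurable_pi_apply j).comp (measurable_pi_apply (X := fun _ : Fin n => Fin k → ℝ) i)

lemma measurable_matrixToEuclidean (n k : ℕ) : Measurable (matrixToEuclidean n k) :=
  (WithLp.measurable_toLp 2 _).comp (measurable_pi_lambda _ fun p => measurable_entry p.1 p.2)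

lemma measurable_matrixToEuclidean_symm (n k : ℕ) : Measurable (matrixToEuclidean n k).symm := by
  refine measurable_pi_lambda _ fun i => measurable_pi_lambda _ fun j => ?_
  exact (measurable_pi_apply (i, j)).comp (WithLp.measurable_ofLp 2 _)

lemma gaussianMatrix_map_matrixToEuclidean (n k : ℕ) :
    (gaussianMatrix n k).map (matrixToEuclidean n k) =
      stdGaussian (EuclideanSpace ℝ (Fin n × Fin k)) := by
  have : IsProbabilityMeasure ((gaussianMatrix n k).map (matrixToEuclidean n k)) :=
    Measure.isProbabilityMeasure_map (measurable_matrixToEuclidean n k).aemeasurable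
  refine Measure.ext_of_charFun ?_
  ext t
  rw [charFun_apply, integral_map (measurable_matrixToEuclidean n k).aemeasurable (by fun_prop),
    charFun_stdGaussian]
  have h1 : ∀ M : Matrix (Fin n) (Fin k) ℝ,
      Complex.exp ((inner ℝ (matrixToEuclidean n k M) t : ℝ) * Complex.I) =
        ∏ i, ∏ j, Complex.exp ((M i j * t (i, j) : ℝ) * Complex.I) := by
    intro M
    simp_rw [← Complex.exp_sum, ← Finset.sum_mul, ← Complex.ofReal_sum]
    rw [PiLp.inner_apply, Fintype.sum_prod_type]
    simp [matrixToEuclidean_apply, mul_comm]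
  simp_rw [h1]
  have h2 : ∫ M, (∏ i, ∏ j, Complex.exp ((M i j * t (i, j) : ℝ) * Complex.I)) ∂gaussianMatrix n k =
      ∏ i, ∏ j, Complex.exp (-(t (i, j)) ^ 2 / 2) := by
    refine (integral_fintype_prod_eq_prod (𝕜 := ℂ)
      (μ := fun _ : Fin n => Measure.pi fun _ : Fin k => gaussianReal 0 1)
      (fun (i : Fin n) (x : Fin k → ℝ) =>
        ∏ j, Complex.exp ((x j * t (i, j) : ℝ) * Complex.I))).trans ?_
    refine Finset.prod_congr rfl fun i _ => ?_
    rw [integral_fintype_prod_eq_prod (𝕜 := ℂ) (fun (j : Fin k) (x : ℝ) =>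
      Complex.exp ((x * t (i, j) : ℝ) * Complex.I))]
    refine Finset.prod_congr rfl fun j _ => ?_
    have := charFun_gaussianReal (μ := 0) (v := 1) (t (i, j))
    rw [charFun_apply_real] at this
    simp only [Complex.ofReal_mul]
    simp_rw [mul_comm _ ((t (i, j) : ℝ) : ℂ)]
    rw [this]
    congr 1
    simp
    ring
  rw [h2]
  simp_rw [← Complex.exp_sum]
  rw [← Fintype.sum_prod_type (f := fun p : Fin n × Fin k => (-((t p : ℝ) : ℂ) ^ 2 / 2)),
    ← Complex.ofReal_pow, EuclideanSpace.real_norm_sq_eq]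
  simp [Finset.sum_div, neg_div]

lemma measurePreserving_gaussianMatrix_of_sum_sq {n k n' k' : ℕ}
    (T : Matrix (Fin n) (Fin k) ℝ ≃ₗ[ℝ] Matrix (Fin n') (Fin k') ℝ)
    (hT : ∀ M, ∑ i, ∑ j, T M i j ^ 2 = ∑ i, ∑ j, M i j ^ 2) :
    MeasurePreserving T (gaussianMatrix n k) (gaussianMatrix n' k') := by
  let L : EuclideanSpace ℝ (Fin n × Fin k) ≃ₗᵢ[ℝ] EuclideanSpace ℝ (Fin n' × Fin k') :=
    { toLinearEquiv := (matrixToEuclidean n k).symm ≪≫ₗ T ≪≫ₗ matrixToEuclidean n' k'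
      norm_map' := by
        intro x
        obtain ⟨M, rfl⟩ := (matrixToEuclidean n k).surjective x
        rw [← sq_eq_sq₀ (norm_nonneg _) (norm_nonneg _), EuclideanSpace.real_norm_sq_eq,
          EuclideanSpace.real_norm_sq_eq, Fintype.sum_prod_type, Fintype.sum_prod_type]
        simpa [matrixToEuclidean_apply] using hT M }
  have hL : (T : Matrix (Fin n) (Fin k) ℝ → Matrix (Fin n') (Fin k') ℝ) =
      (matrixToEuclidean n' k').symm ∘ (L ∘ matrixToEuclidean n k) := by
    ext1 M
    simp [L]
  have hLm : Measurable L := L.continuous.measurable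
  have h1 := measurable_matrixToEuclidean n k
  have h2 := measurable_matrixToEuclidean_symm n' k'
  have h3 : (gaussianMatrix n' k') =
      (stdGaussian (EuclideanSpace ℝ (Fin n' × Fin k'))).map (matrixToEuclidean n' k').symm := by
    rw [← gaussianMatrix_map_matrixToEuclidean, Measure.map_map h2
      (measurable_matrixToEuclidean n' k')]
    have : (matrixToEuclidean n' k').symm ∘ (matrixToEuclidean n' k') = id := by ext1 M; simp
    rw [this, Measure.map_id]
  refine ⟨by rw [hL]; exact h2.comp (hLm.comp h1), ?_⟩
  rw [hL, ← Measure.map_map h2 (hLm.comp h1), ← Measure.map_map hLm h1,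
    gaussianMatrix_map_matrixToEuclidean, stdGaussian_map, h3]

lemma measurePreserving_transpose_gaussianMatrix (n k : ℕ) :
    MeasurePreserving (fun M : Matrix (Fin n) (Fin k) ℝ => Mᵀ)
      (gaussianMatrix n k) (gaussianMatrix k n) :=
  measurePreserving_gaussianMatrix_of_sum_sq (transposeLinearEquiv (Fin n) (Fin k) ℝ ℝ)
    fun _ => Finset.sum_comm

lemma sum_sq_eq_trace {n k : ℕ} (M : Matrix (Fin n) (Fin k) ℝ) :
    ∑ i, ∑ j, M i j ^ 2 = (Mᵀ * M).trace := by
  simp only [trace, diag_apply, mul_apply, transpose_apply, sq]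
  exact Finset.sum_comm

lemma measurePreserving_mul_left_gaussianMatrix {n k : ℕ} {U : Matrix (Fin n) (Fin n) ℝ}
    (hU : Uᵀ * U = 1) :
    MeasurePreserving (fun M : Matrix (Fin n) (Fin k) ℝ => U * M)
      (gaussianMatrix n k) (gaussianMatrix n k) := by
  have hU' : U * Uᵀ = 1 := mul_eq_one_comm.1 hU
  let T : Matrix (Fin n) (Fin k) ℝ ≃ₗ[ℝ] Matrix (Fin n) (Fin k) ℝ :=
    { toFun := fun M => U * M
      invFun := fun M => Uᵀ * M
      map_add' := fun _ _ => Matrix.mul_add _ _ _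
      map_smul' := fun _ _ => Matrix.mul_smul _ _ _
      left_inv := fun M => by
        change Uᵀ * (U * M) = M
        rw [← Matrix.mul_assoc, hU, Matrix.one_mul]
      right_inv := fun M => by
        change U * (Uᵀ * M) = M
        rw [← Matrix.mul_assoc, hU', Matrix.one_mul] }
  refine measurePreserving_gaussianMatrix_of_sum_sq T fun M => ?_
  change ∑ i, ∑ j, (U * M) i j ^ 2 = _
  rw [sum_sq_eq_trace, sum_sq_eq_trace, transpose_mul, Matrix.mul_assoc, ← Matrix.mul_assoc Uᵀ, hU,
    Matrix.one_mul]

lemma measurePreserving_mul_right_gaussianMatrix {n k : ℕ} {P : Matrix (Fin k) (Fin k) ℝ}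
    (hP : Pᵀ * P = 1) :
    MeasurePreserving (fun M : Matrix (Fin n) (Fin k) ℝ => M * P)
      (gaussianMatrix n k) (gaussianMatrix n k) := by
  have h := ((measurePreserving_transpose_gaussianMatrix k n).comp
    (measurePreserving_mul_left_gaussianMatrix (U := Pᵀ) (by
      rw [transpose_transpose]; exact mul_eq_one_comm.1 hP))).comp
    (measurePreserving_transpose_gaussianMatrix n k)
  convert h using 1
  ext1 M
  simp

end GaussianMatrix

section DiagonalOfQR

/-- The columns of `A`, extended by zeros to a family of `n` vectors in `ℝⁿ`. -/
noncomputable def columnFamily {n k : ℕ} (A : Matrix (Fin n) (Fin k) ℝ) (i : Fin n) :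
    EuclideanSpace ℝ (Fin n) :=
  if h : (i : ℕ) < k then WithLp.toLp 2 fun l => A l ⟨i, h⟩ else 0

variable {n k : ℕ} (hkn : k ≤ n)

lemma columnFamily_castLE (A : Matrix (Fin n) (Fin k) ℝ) (i : Fin k) :
    columnFamily A (Fin.castLE hkn i) = WithLp.toLp 2 fun l => A l i := by
  simp [columnFamily]

lemma measurable_columnFamily (i : Fin n) :
    Measurable fun A : Matrix (Fin n) (Fin k) ℝ => columnFamily A i := by
  unfold columnFamily
  split_ifs with h
  · exact (WithLp.measurable_toLp 2 _).comp (measurable_pi_lambda _ fun l => measurable_entry l _)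
  · exact measurable_const

lemma columnFamily_transpose_update (B : Fin k → Fin n → ℝ) (i : Fin k) (x : Fin n → ℝ) :
    columnFamily (Matrix.of (Function.update B i x))ᵀ =
      Function.update (columnFamily (Matrix.of B)ᵀ) (Fin.castLE hkn i) (WithLp.toLp 2 x) := by
  ext1 j
  by_cases hj : j = Fin.castLE hkn i
  · subst hj
    rw [columnFamily_castLE, Function.update_self]
    simp
  · rw [Function.update_of_ne hj]
    unfold columnFamily
    split_ifs with h
    · congr 1
      ext l
      have : (⟨j, h⟩ : Fin k) ≠ i := by
        rintro rfl
        exact hj (by ext; simp)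
      simp [this]
    · rfl

/-- The `i`-th diagonal entry of the triangular factor in the QR decomposition of `A`. -/
noncomputable def qrDiag (A : Matrix (Fin n) (Fin k) ℝ) (i : Fin k) : ℝ :=
  ‖InnerProductSpace.gramSchmidt ℝ (columnFamily A) (Fin.castLE hkn i)‖

lemma measurable_qrDiag (i : Fin k) :
    Measurable fun A : Matrix (Fin n) (Fin k) ℝ => qrDiag hkn A i :=
  (measurable_gramSchmidt (fun j => measurable_columnFamily j) _).norm

lemma integrable_qrDiag (i : Fin k) :
    Integrable (fun A : Matrix (Fin n) (Fin k) ℝ => qrDiag hkn A i) (gaussianMatrix n k) := by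
  have h1 : Integrable (fun x => ‖x‖) (stdGaussian (EuclideanSpace ℝ (Fin n × Fin k))) :=
    IsGaussian.integrable_id.norm
  rw [← gaussianMatrix_map_matrixToEuclidean, integrable_map_measure (by fun_prop)
    (measurable_matrixToEuclidean n k).aemeasurable] at h1
  refine h1.mono' (measurable_qrDiag hkn i).aestronglyMeasurable
    (Filter.Eventually.of_forall fun A => ?_)
  rw [qrDiag, norm_norm]
  refine (norm_gramSchmidt_le _ _).trans ?_
  rw [columnFamily_castLE, Function.comp_apply, ← sq_le_sq₀ (norm_nonneg _) (norm_nonneg _),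
    EuclideanSpace.real_norm_sq_eq, EuclideanSpace.real_norm_sq_eq, Fintype.sum_prod_type]
  refine Finset.sum_le_sum fun l _ => ?_
  exact Finset.single_le_sum (f := fun j => matrixToEuclidean n k A (l, j) ^ 2)
    (fun j _ => sq_nonneg _) (Finset.mem_univ i)

lemma chiSqrtMoment_le_integral_qrDiag (i : Fin k) :
    chiSqrtMoment ((n : ℝ) - i) ≤ ∫ A, qrDiag hkn A i ∂(gaussianMatrix n k) := by
  have hin : (i : ℕ) < n := i.2.trans_le hkn
  have hcard : (Finset.Iio (Fin.castLE hkn i)).card = i := by simp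
  have hint := integrable_qrDiag hkn i
  have hmT : Measurable fun B : Fin k → Fin n → ℝ => qrDiag hkn (Matrix.of B)ᵀ i :=
    (measurable_qrDiag hkn i).comp (measurePreserving_transpose_gaussianMatrix k n).measurable
  rw [integral_eq_lintegral_of_nonneg_ae (f := fun A => qrDiag hkn A i)
    (Filter.Eventually.of_forall fun _ => norm_nonneg _) hint.aestronglyMeasurable,
    ← ENNReal.ofReal_le_iff_le_toReal hint.lintegral_lt_top.ne,
    ← (measurePreserving_transpose_gaussianMatrix k n).lintegral_comp
    (measurable_qrDiag hkn i).ennreal_ofReal]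
  have key := lintegral_le_of_lmarginal_le
    (μ := fun _ : Fin k => Measure.pi fun _ : Fin n => gaussianReal 0 1) {i}
    (f := fun _ => ENNReal.ofReal (chiSqrtMoment ((n : ℝ) - i)))
    (g := fun B => ENNReal.ofReal (qrDiag hkn (Matrix.of B)ᵀ i)) measurable_const
    hmT.ennreal_ofReal (by
      rw [lmarginal_singleton, lmarginal_singleton]
      intro B
      have h1 := chiSqrtMoment_le_integral_norm_gramSchmidt_update
        (columnFamily (Matrix.of B)ᵀ) (Fin.castLE hkn i) (by simpa using hin)
      have hm : Measurable fun x => ‖InnerProductSpace.gramSchmidt ℝ (Function.update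
          (columnFamily (Matrix.of B)ᵀ) (Fin.castLE hkn i) x) (Fin.castLE hkn i)‖ :=
        (measurable_gramSchmidt (fun j =>
          (measurable_pi_apply j).comp (measurable_update (columnFamily (Matrix.of B)ᵀ))) _).norm
      simp only [lintegral_const, measure_univ, mul_one]
      rw [integral_eq_lintegral_of_nonneg_ae (Filter.Eventually.of_forall fun _ => norm_nonneg _)
        hm.aestronglyMeasurable, ← map_pi_eq_stdGaussian,
        lintegral_map hm.ennreal_ofReal (WithLp.measurable_toLp 2 _)] at h1
      simp_rw [← columnFamily_transpose_update] at h1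
      rw [finrank_euclideanSpace_fin, hcard, Nat.cast_sub hin.le] at h1
      exact (ENNReal.ofReal_le_ofReal h1).trans ENNReal.ofReal_toReal_le)
  refine le_trans ?_ key
  simp

end DiagonalOfQR

section SignedPermutation

/-- The isometric inclusion of `ℝᵏ` in `ℝⁿ` onto the first `k` coordinates. -/
def inclusionMatrix {n k : ℕ} (hkn : k ≤ n) : Matrix (Fin n) (Fin k) ℝ :=
  of fun i j => if i = Fin.castLE hkn j then 1 else 0

/-- The permutation matrix of `σ` with its rows multiplied by the signs `ε`. -/
def signedPermMatrix {m : ℕ} (ε : Fin m → ℤˣ) (σ : Equiv.Perm (Fin m)) :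
    Matrix (Fin m) (Fin m) ℝ :=
  of fun i l => if l = σ i then ((ε i : ℤ) : ℝ) else 0

variable {m n k : ℕ}

lemma intUnit_mul_self (u : ℤˣ) : ((u : ℤ) : ℝ) * ((u : ℤ) : ℝ) = 1 := by
  rcases Int.units_eq_one_or u with rfl | rfl <;> simp

lemma signedPermMatrix_mul_apply (ε : Fin m → ℤˣ) (σ : Equiv.Perm (Fin m))
    (M : Matrix (Fin m) (Fin k) ℝ) (i : Fin m) (j : Fin k) :
    (signedPermMatrix ε σ * M) i j = ((ε i : ℤ) : ℝ) * M (σ i) j := by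
  simp [signedPermMatrix, mul_apply]

lemma mul_transpose_signedPermMatrix_apply (ε : Fin m → ℤˣ) (σ : Equiv.Perm (Fin m))
    (M : Matrix (Fin n) (Fin m) ℝ) (i : Fin n) (j : Fin m) :
    (M * (signedPermMatrix ε σ)ᵀ) i j = ((ε j : ℤ) : ℝ) * M i (σ j) := by
  simp [signedPermMatrix, mul_apply, mul_comm]

lemma signedPermMatrix_mul_transpose (ε : Fin m → ℤˣ) (σ : Equiv.Perm (Fin m)) :
    signedPermMatrix ε σ * (signedPermMatrix ε σ)ᵀ = 1 := by
  ext i j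
  rw [mul_transpose_signedPermMatrix_apply]
  by_cases h : i = j
  · subst h
    simp [signedPermMatrix, intUnit_mul_self]
  · simp [signedPermMatrix, h, Ne.symm h]

lemma signedPermMatrix_transpose_mul (ε : Fin m → ℤˣ) (σ : Equiv.Perm (Fin m)) :
    (signedPermMatrix ε σ)ᵀ * signedPermMatrix ε σ = 1 :=
  mul_eq_one_comm.1 (signedPermMatrix_mul_transpose ε σ)

lemma sum_sign_mul_sign_of_ne {i j : Fin m} (h : i ≠ j) :
    ∑ ε : Fin m → ℤˣ, ((ε i : ℤ) : ℝ) * ((ε j : ℤ) : ℝ) = 0 := by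
  have h1 := Equiv.sum_comp (Equiv.mulLeft (Pi.mulSingle i (-1 : ℤˣ) : Fin m → ℤˣ))
    fun ε => ((ε i : ℤ) : ℝ) * ((ε j : ℤ) : ℝ)
  simp only [Equiv.coe_mulLeft, Pi.mul_apply, Pi.mulSingle_eq_same,
    Pi.mulSingle_eq_of_ne (M := fun _ : Fin m => ℤˣ) h.symm, one_mul, neg_mul, Units.val_neg,
    Int.cast_neg, Finset.sum_neg_distrib] at h1
  linarith

variable (hkn : k ≤ n)

/-- The left factor of the symmetrization of `n × k` matrices. -/
noncomputable def symmLeft [NeZero k] (s : (Fin n → ℤˣ) × Fin k) : Matrix (Fin n) (Fin n) ℝ :=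
  signedPermMatrix s.1 ((Equiv.addRight s.2).viaEmbedding (Fin.castLEEmb hkn))

/-- The right factor of the symmetrization of `n × k` matrices. -/
def symmRight [NeZero k] (s : (Fin n → ℤˣ) × Fin k) : Matrix (Fin k) (Fin k) ℝ :=
  (signedPermMatrix (s.1 ∘ Fin.castLE hkn) (Equiv.addRight s.2))ᵀ

lemma sum_symmLeft_mul_mul_symmRight [NeZero k] (B : Matrix (Fin n) (Fin k) ℝ) :
    ∑ s, symmLeft hkn s * B * symmRight hkn s =
      ((2 : ℝ) ^ n * ∑ i, B (Fin.castLE hkn i) i) • inclusionMatrix hkn := by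
  ext i j
  rw [Matrix.sum_apply, Fintype.sum_prod_type, Finset.sum_comm]
  simp only [symmLeft, symmRight, mul_transpose_signedPermMatrix_apply, signedPermMatrix_mul_apply,
    Function.comp_apply, Matrix.smul_apply, inclusionMatrix, of_apply, smul_eq_mul]
  split_ifs with h
  · subst h
    simp only [← mul_assoc, intUnit_mul_self, one_mul, mul_one]
    have h1 : ∀ c : Fin k, ((Equiv.addRight c).viaEmbedding (Fin.castLEEmb hkn))
        (Fin.castLE hkn j) = Fin.castLE hkn (j + c) := fun c =>
      Equiv.Perm.viaEmbedding_apply (Equiv.addRight c) (Fin.castLEEmb hkn) j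
    simp only [h1, Equiv.coe_addRight, Finset.sum_const, Finset.card_univ, ← Finset.smul_sum]
    have h2 := Equiv.sum_comp (Equiv.addLeft j) fun c => B (Fin.castLE hkn c) c
    rw [Equiv.coe_addLeft] at h2
    rw [h2]
    simp
  · simp_rw [← mul_assoc, ← Finset.sum_mul, mul_comm ((_ : ℤ) : ℝ) ((_ : ℤ) : ℝ)]
    simp [sum_sign_mul_sign_of_ne h]

/-- A convex function invariant under the orthogonal group, averaged over the signed column
permutations of `B`, dominates its value at the inclusion matrix scaled by the mean of the
diagonal of `B`. -/
lemma map_smul_inclusionMatrix_le [NeZero k] {F : Matrix (Fin n) (Fin k) ℝ → ℝ}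
    (hF : ConvexOn ℝ Set.univ F)
    (hinv : ∀ U : Matrix (Fin n) (Fin n) ℝ, Uᵀ * U = 1 → ∀ A, F (U * A) = F A)
    (B : Matrix (Fin n) (Fin k) ℝ) :
    F (((∑ i, B (Fin.castLE hkn i) i) / k) • inclusionMatrix hkn) ≤
      ∑ s, (1 / (2 ^ n * k) : ℝ) * F (B * symmRight hkn s) := by
  have hk : (k : ℝ) ≠ 0 := Nat.cast_ne_zero.2 (NeZero.ne k)
  have h := hF.map_sum_le (t := Finset.univ) (w := fun _ => (1 / (2 ^ n * k) : ℝ))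
    (p := fun s => symmLeft hkn s * B * symmRight hkn s) (fun _ _ => by positivity)
    (by simp; field_simp) (fun _ _ => Set.mem_univ _)
  rw [← Finset.smul_sum, sum_symmLeft_mul_mul_symmRight, smul_smul] at h
  have hscal : 1 / (2 ^ n * k) * (2 ^ n * ∑ i, B (Fin.castLE hkn i) i) =
      (∑ i, B (Fin.castLE hkn i) i) / k := by
    field_simp
  rw [hscal] at h
  refine h.trans_eq (Finset.sum_congr rfl fun s _ => ?_)
  rw [smul_eq_mul, Matrix.mul_assoc, hinv]
  exact signedPermMatrix_transpose_mul _ _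

end SignedPermutation

section OrthogonalFrames

variable {n k : ℕ} (hkn : k ≤ n)

lemma exists_orthogonal_mul_apply_eq_qrDiag (A : Matrix (Fin n) (Fin k) ℝ) :
    ∃ U : Matrix (Fin n) (Fin n) ℝ, Uᵀ * U = 1 ∧
      ∀ i, (U * A) (Fin.castLE hkn i) i = qrDiag hkn A i := by
  have hc : Module.finrank ℝ (EuclideanSpace ℝ (Fin n)) = Fintype.card (Fin n) := by simp
  let b := InnerProductSpace.gramSchmidtOrthonormalBasis hc (columnFamily A)
  refine ⟨of fun i l => b i l, mul_eq_one_comm.1 ?_, fun i => ?_⟩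
  · ext i j
    have := orthonormal_iff_ite.1 b.orthonormal i j
    rw [one_apply, ← this, PiLp.inner_apply, mul_apply]
    simp [mul_comm]
  · have := inner_gramSchmidtOrthonormalBasis_self hc (columnFamily A) (Fin.castLE hkn i)
    rw [qrDiag, ← this, columnFamily_castLE, PiLp.inner_apply, mul_apply]
    simp [b, mul_comm]

lemma exists_orthogonal_mul_inclusionMatrix {Q : Matrix (Fin n) (Fin k) ℝ} (hQ : Qᵀ * Q = 1) :
    ∃ V : Matrix (Fin n) (Fin n) ℝ, Vᵀ * V = 1 ∧ Q = V * inclusionMatrix hkn := by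
  have horth : Orthonormal ℝ ({i : Fin n | (i : ℕ) < k}.domRestrict (columnFamily Q)) := by
    rw [orthonormal_iff_ite]
    rintro ⟨i, hi⟩ ⟨j, hj⟩
    have h := congrFun (congrFun hQ ⟨i, hi⟩) ⟨j, hj⟩
    simp only [Set.mem_ofPred_eq] at hi hj
    rw [mul_apply, one_apply] at h
    simpa [columnFamily, hi, hj, PiLp.inner_apply, mul_comm, Fin.ext_iff] using h
  obtain ⟨b, hb⟩ := horth.exists_orthonormalBasis_extension_of_card_eq (by simp)
  refine ⟨of fun l i => b i l, ?_, ?_⟩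
  · ext i j
    have := orthonormal_iff_ite.1 b.orthonormal i j
    rw [one_apply, ← this, PiLp.inner_apply, mul_apply]
    simp [mul_comm]
  · ext l j
    have := hb (Fin.castLE hkn j) (by simp)
    simp [mul_apply, inclusionMatrix, this, columnFamily_castLE]

end OrthogonalFrames

section InvariantConvexFunctions

lemma ConvexOn.exists_nonneg_forall_add_mul_le {φ : ℝ → ℝ} (hφ : ConvexOn ℝ Set.univ φ)
    (h : φ (-1) = φ 1) : ∃ m, 0 ≤ m ∧ ∀ t, φ 1 + m * (t - 1) ≤ φ t := by
  have hi : (1 : ℝ) ∈ interior Set.univ := by simp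
  have key : ∀ t, φ 1 + derivWithin φ (Set.Ioi 1) 1 * (t - 1) ≤ φ t := by
    intro t
    rcases lt_trichotomy t 1 with ht | rfl | ht
    · have h1 := hφ.slope_le_leftDeriv_of_mem_interior (Set.mem_univ t) hi ht
      have h2 := hφ.leftDeriv_le_rightDeriv_of_mem_interior hi
      rw [slope_def_field] at h1
      have h3 := (div_le_iff₀ (by linarith)).1 (h1.trans h2)
      linarith
    · simp
    · have h1 := hφ.rightDeriv_le_slope_of_mem_interior hi (Set.mem_univ t) ht
      rw [slope_def_field] at h1
      have h3 := (le_div_iff₀ (by linarith)).1 h1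
      linarith
  exact ⟨_, by linarith [key (-1)], key⟩

variable {n k : ℕ} (hkn : k ≤ n)

lemma natCast_mul_alphaConst [NeZero k] :
    k * alphaConst k n = ∑ i : Fin k, chiSqrtMoment ((n : ℝ) - i) := by
  have hk : (k : ℝ) ≠ 0 := Nat.cast_ne_zero.2 (NeZero.ne k)
  rw [alphaConst, ← mul_assoc, mul_one_div_cancel hk, one_mul,
    Fin.sum_univ_eq_sum_range fun i => chiSqrtMoment ((n : ℝ) - i), Finset.range_eq_Ico,
    ← Finset.Ico_add_one_right_eq_Icc, Finset.sum_Ico_eq_sum_range, Finset.range_eq_Ico]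
  refine Finset.sum_congr (by simp) fun i _ => ?_
  push_cast
  congr 1
  ring

lemma alphaConst_pos [NeZero k] (hkn : k ≤ n) : 0 < alphaConst k n := by
  have hk : (0 : ℝ) < k := Nat.cast_pos.2 (NeZero.pos k)
  refine pos_of_mul_pos_right (a := (k : ℝ)) ?_ hk.le
  rw [natCast_mul_alphaConst]
  exact Finset.sum_pos (fun i _ => chiSqrtMoment_pos
    (sub_pos.2 (by exact_mod_cast i.2.trans_le hkn))) Finset.univ_nonempty

/-- The comparison principle for convex functions invariant under the orthogonal group. -/
lemma map_inclusionMatrix_le_integral [NeZero k] {F : Matrix (Fin n) (Fin k) ℝ → ℝ}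
    (hF : ConvexOn ℝ Set.univ F)
    (hinv : ∀ U : Matrix (Fin n) (Fin n) ℝ, Uᵀ * U = 1 → ∀ A, F (U * A) = F A)
    (hint : Integrable (fun A => F ((alphaConst k n)⁻¹ • A)) (gaussianMatrix n k)) :
    F (inclusionMatrix hkn) ≤ ∫ A, F ((alphaConst k n)⁻¹ • A) ∂gaussianMatrix n k := by
  have hk : (0 : ℝ) < k := Nat.cast_pos.2 (NeZero.pos k)
  have hα : 0 < alphaConst k n := alphaConst_pos hkn
  set c := (alphaConst k n)⁻¹ with hc
  have hc0 : 0 < c := inv_pos.2 hα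
  have hFc : ConvexOn ℝ Set.univ fun A => F (c • A) :=
    hF.comp_linearMap (LinearMap.lsmul ℝ (Matrix (Fin n) (Fin k) ℝ) c)
  have hinvc : ∀ U : Matrix (Fin n) (Fin n) ℝ, Uᵀ * U = 1 → ∀ A, F (c • (U * A)) = F (c • A) := by
    intro U hU A
    rw [← Matrix.mul_smul, hinv U hU]
  have hφ : ConvexOn ℝ Set.univ fun t : ℝ => F (t • inclusionMatrix hkn) :=
    hF.comp_linearMap (LinearMap.toSpanSingleton ℝ _ (inclusionMatrix hkn))
  obtain ⟨m, hm0, hm⟩ := hφ.exists_nonneg_forall_add_mul_le (by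
    have := hinv (-1) (by simp) (inclusionMatrix hkn)
    simpa using this)
  simp only [one_smul] at hm
  have hR : ∀ s, (symmRight hkn s)ᵀ * symmRight hkn s = 1 := fun s => by
    rw [symmRight, transpose_transpose, signedPermMatrix_mul_transpose]
  have hmp := fun s => measurePreserving_mul_right_gaussianMatrix (n := n) (hR s)
  have hints : ∀ s, Integrable (fun A => F (c • (A * symmRight hkn s))) (gaussianMatrix n k) :=
    fun s => (hmp s).integrable_comp_of_integrable hint
  have hpt : ∀ A, F (inclusionMatrix hkn) + m * (c * ((∑ i, qrDiag hkn A i) / k) - 1) ≤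
      ∑ s, (1 / (2 ^ n * k) : ℝ) * F (c • (A * symmRight hkn s)) := by
    intro A
    obtain ⟨U, hU, hUA⟩ := exists_orthogonal_mul_apply_eq_qrDiag hkn A
    have h1 := map_smul_inclusionMatrix_le hkn hFc hinvc (U * A)
    simp only [hUA, smul_smul, Matrix.mul_assoc, hinvc U hU] at h1
    exact (hm _).trans h1
  have hqi := fun i => integrable_qrDiag hkn (i : Fin k)
  have hsum : Integrable (fun A => ∑ i, qrDiag hkn A i) (gaussianMatrix n k) :=
    integrable_finsetSum _ fun i _ => hqi i
  have hlin : Integrable (fun A => m * (c * ((∑ i, qrDiag hkn A i) / k) - 1))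
      (gaussianMatrix n k) :=
    (((hsum.div_const _).const_mul _).sub (integrable_const _)).const_mul _
  have h2 := integral_mono ((integrable_const _).add hlin)
    (integrable_finsetSum _ fun s _ => (hints s).const_mul _) hpt
  have hs : ∀ s, ∫ A, F (c • (A * symmRight hkn s)) ∂gaussianMatrix n k =
      ∫ A, F (c • A) ∂gaussianMatrix n k := fun s => by
    have h3 := (hmp s).map_eq
    conv_rhs => rw [← h3]
    rw [integral_map (hmp s).measurable.aemeasurable]
    rw [h3]
    exact hint.aestronglyMeasurable
  have hge : alphaConst k n ≤ (∫ A, ∑ i, qrDiag hkn A i ∂gaussianMatrix n k) / k := by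
    rw [le_div_iff₀ hk, mul_comm, natCast_mul_alphaConst, integral_finsetSum _ fun i _ => hqi i]
    exact Finset.sum_le_sum fun i _ => chiSqrtMoment_le_integral_qrDiag hkn i
  have hge' : 1 ≤ c * ((∫ A, ∑ i, qrDiag hkn A i ∂gaussianMatrix n k) / k) := by
    rw [← inv_mul_cancel₀ hα.ne']
    exact mul_le_mul_of_nonneg_left hge hc0.le
  have hrhs : ∫ A, ∑ s, (1 / (2 ^ n * k) : ℝ) * F (c • (A * symmRight hkn s)) ∂gaussianMatrix n k =
      ∫ A, F (c • A) ∂gaussianMatrix n k := by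
    rw [integral_finsetSum _ fun s _ => (hints s).const_mul _]
    simp only [integral_const_mul, hs, Finset.sum_const, Finset.card_univ, Fintype.card_prod,
      Fintype.card_fun, Fintype.card_fin, Fintype.card_units_int]
    simp
    field_simp
  simp only [Pi.add_apply] at h2
  rw [hrhs, integral_add (integrable_const _) hlin, integral_const_mul, integral_sub
    ((hsum.div_const _).const_mul _) (integrable_const _), integral_const_mul, integral_div,
    integral_const, integral_const, probReal_univ, one_smul, one_smul] at h2
  exact le_of_add_le_of_nonneg_left h2 (mul_nonneg hm0 (sub_nonneg.2 hge'))

end InvariantConvexFunctions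

section OrbitAverage

instance (n k : ℕ) : SecondCountableTopology (Matrix (Fin n) (Fin k) ℝ) :=
  inferInstanceAs (SecondCountableTopology (Fin n → Fin k → ℝ))

instance (n : ℕ) : CompactSpace (orthogonalGroup (Fin n) ℝ) := by
  refine isCompact_iff_compactSpace.1 (IsCompact.of_isClosed_subset
    (isCompact_univ_pi fun _ : Fin n => isCompact_univ_pi fun _ : Fin n =>
      isCompact_Icc (a := (-1 : ℝ)) (b := 1)) isClosed_unitary ?_)
  intro U hU i _ j _
  have := entry_norm_bound_of_unitary (𝕜 := ℝ) hU i j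
  exact abs_le.1 this

instance (n : ℕ) : BorelSpace (orthogonalGroup (Fin n) ℝ) :=
  Subtype.borelSpace _

/-- The right-invariant probability measure on the orthogonal group. -/
noncomputable def orthogonalHaar (n : ℕ) : Measure (orthogonalGroup (Fin n) ℝ) :=
  (Measure.haarMeasure ⊤).inv

instance (n : ℕ) : (orthogonalHaar n).IsMulRightInvariant :=
  inferInstanceAs (Measure.haarMeasure (G := orthogonalGroup (Fin n) ℝ) ⊤).inv.IsMulRightInvariant

instance (n : ℕ) : IsProbabilityMeasure (orthogonalHaar n) := by
  constructor
  rw [orthogonalHaar, Measure.inv_apply, Set.inv_univ]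
  exact Measure.haarMeasure_self (K₀ := (⊤ : TopologicalSpace.PositiveCompacts _))

variable {n k : ℕ}

lemma transpose_mul_self_of_mem (O : orthogonalGroup (Fin n) ℝ) :
    (O : Matrix (Fin n) (Fin n) ℝ)ᵀ * O = 1 :=
  (mem_orthogonalGroup_iff' _ _).1 O.2

lemma ConvexOn.continuous_matrix {f : Matrix (Fin n) (Fin k) ℝ → ℝ}
    (hf : ConvexOn ℝ Set.univ f) : Continuous f := by
  have h : ConvexOn ℝ Set.univ (fun x : Fin n → Fin k → ℝ => f (of x)) := hf
  exact continuousOn_univ.1 (h.continuousOn isOpen_univ)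

/-- The average of `f` over the orbits of the orthogonal group acting by left multiplication. -/
noncomputable def orbitAverage (f : Matrix (Fin n) (Fin k) ℝ → ℝ) (A : Matrix (Fin n) (Fin k) ℝ) :
    ℝ :=
  ∫ O, f ((O : Matrix (Fin n) (Fin n) ℝ) * A) ∂orthogonalHaar n

lemma integrable_orbit {f : Matrix (Fin n) (Fin k) ℝ → ℝ} (hf : Continuous f)
    (A : Matrix (Fin n) (Fin k) ℝ) :
    Integrable (fun O : orthogonalGroup (Fin n) ℝ => f (O.1 * A)) (orthogonalHaar n) :=
  Continuous.integrable_of_hasCompactSupport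
    (hf.comp (continuous_subtype_val.matrix_mul continuous_const))
    (HasCompactSupport.of_compactSpace _)

lemma convexOn_orbitAverage {f : Matrix (Fin n) (Fin k) ℝ → ℝ} (hf : ConvexOn ℝ Set.univ f) :
    ConvexOn ℝ Set.univ (orbitAverage f) := by
  have hi := integrable_orbit hf.continuous_matrix
  refine ⟨convex_univ, fun A _ B _ a b ha hb hab => ?_⟩
  simp only [orbitAverage, smul_eq_mul]
  rw [← integral_const_mul, ← integral_const_mul,
    ← integral_add ((hi A).const_mul a) ((hi B).const_mul b)]
  refine integral_mono (hi _) (((hi A).const_mul a).add ((hi B).const_mul b)) fun O => ?_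
  simp only [Matrix.mul_add, Matrix.mul_smul]
  exact hf.2 (Set.mem_univ _) (Set.mem_univ _) ha hb hab

lemma orbitAverage_mul (f : Matrix (Fin n) (Fin k) ℝ → ℝ) {U : Matrix (Fin n) (Fin n) ℝ}
    (hU : Uᵀ * U = 1) (A : Matrix (Fin n) (Fin k) ℝ) :
    orbitAverage f (U * A) = orbitAverage f A := by
  have h := integral_mul_right_eq_self (μ := orthogonalHaar n)
    (fun O : orthogonalGroup (Fin n) ℝ => f (O.1 * A)) ⟨U, (mem_orthogonalGroup_iff' _ _).2 hU⟩
  simpa [orbitAverage, Matrix.mul_assoc] using h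

lemma measurable_orthogonal_mul : Measurable
    fun p : orthogonalGroup (Fin n) ℝ × Matrix (Fin n) (Fin k) ℝ => p.1.1 * p.2 :=
  (Continuous.matrix_mul (by fun_prop) (by fun_prop)).measurable

lemma measurePreserving_orthogonal_mul {ν : Measure (Matrix (Fin n) (Fin k) ℝ)}
    [IsProbabilityMeasure ν]
    (hν : ∀ U : Matrix (Fin n) (Fin n) ℝ, Uᵀ * U = 1 → ν.map (fun A => U * A) = ν) :
    MeasurePreserving
      (fun p : orthogonalGroup (Fin n) ℝ × Matrix (Fin n) (Fin k) ℝ => p.1.1 * p.2)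
      ((orthogonalHaar n).prod ν) ν :=
  measurePreserving_snd.comp ((MeasurePreserving.id (orthogonalHaar n)).skew_product
    (g := fun O A => O.1 * A) measurable_orthogonal_mul
    (Filter.Eventually.of_forall fun O => hν O.1 (transpose_mul_self_of_mem O)))

lemma integrable_orbitAverage {ν : Measure (Matrix (Fin n) (Fin k) ℝ)} [IsProbabilityMeasure ν]
    (hν : ∀ U : Matrix (Fin n) (Fin n) ℝ, Uᵀ * U = 1 → ν.map (fun A => U * A) = ν)
    {f : Matrix (Fin n) (Fin k) ℝ → ℝ} (hf : Integrable f ν) :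
    Integrable (orbitAverage f) ν :=
  ((measurePreserving_orthogonal_mul hν).integrable_comp_of_integrable hf).integral_prod_right

lemma integral_orbitAverage {ν : Measure (Matrix (Fin n) (Fin k) ℝ)} [IsProbabilityMeasure ν]
    (hν : ∀ U : Matrix (Fin n) (Fin n) ℝ, Uᵀ * U = 1 → ν.map (fun A => U * A) = ν)
    {f : Matrix (Fin n) (Fin k) ℝ → ℝ} (hf : Integrable f ν) :
    ∫ A, orbitAverage f A ∂ν = ∫ A, f A ∂ν := by
  have hmp := measurePreserving_orthogonal_mul hν
  have h1 := integral_prod_symm _ (hmp.integrable_comp_of_integrable hf)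
  refine h1.symm.trans ?_
  have hf' := hf.aestronglyMeasurable
  rw [← hmp.map_eq] at hf'
  have h2 := integral_map hmp.measurable.aemeasurable hf'
  rw [hmp.map_eq] at h2
  exact h2.symm

lemma Continuous.integrable_of_ae_transpose_mul_self {f : Matrix (Fin n) (Fin k) ℝ → ℝ}
    (hf : Continuous f) (hkn : k ≤ n) {μ : Measure (Matrix (Fin n) (Fin k) ℝ)} [IsFiniteMeasure μ]
    (hμ : ∀ᵐ Q ∂μ, Qᵀ * Q = 1) :
    Integrable f μ := by
  obtain ⟨C, hC⟩ := isCompact_univ.exists_bound_of_continuousOn (hf.comp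
    (continuous_subtype_val.matrix_mul (continuous_const (y := inclusionMatrix hkn)))).continuousOn
    (s := (Set.univ : Set (orthogonalGroup (Fin n) ℝ)))
  refine Integrable.of_bound hf.aestronglyMeasurable C ?_
  filter_upwards [hμ] with Q hQ
  obtain ⟨V, hV, rfl⟩ := exists_orthogonal_mul_inclusionMatrix hkn hQ
  exact hC ⟨V, (mem_orthogonalGroup_iff' _ _).2 hV⟩ (Set.mem_univ _)

end OrbitAverage

/-- **Convex comparison principle.**  Let `k ≤ n`, let `μ` be the Haar probability measure
on the Stiefel manifold `V_k^n`, and let `γ` be the law of an `n × k` matrix with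
independent `N(0,1)` entries.  For every convex `f`, `E f(Q) ≤ E f(α⁻¹ Γ)`. -/
theorem convex_comparison_principle
    (n k : ℕ) (hn : 0 < n) (hk : 0 < k) (hkn : k ≤ n)
    (μ : Measure (Matrix (Fin n) (Fin k) ℝ)) [IsProbabilityMeasure μ]
    (hμ_stiefel : ∀ᵐ Q ∂μ, Qᵀ * Q = 1)
    (hμ_inv : ∀ U : Matrix (Fin n) (Fin n) ℝ, Uᵀ * U = 1 →
      μ.map (fun Q => U * Q) = μ)
    (γ : Measure (Matrix (Fin n) (Fin k) ℝ))
    (hγ : γ = Measure.pi fun _ : Fin n => Measure.pi fun _ : Fin k => gaussianReal 0 1)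
    (f : Matrix (Fin n) (Fin k) ℝ → ℝ)
    (hf : ConvexOn ℝ Set.univ f)
    (hint : Integrable (fun M => f ((alphaConst k n)⁻¹ • M)) γ) :
    ∫ Q, f Q ∂μ ≤ ∫ M, f ((alphaConst k n)⁻¹ • M) ∂γ := by
  have : NeZero k := ⟨hk.ne'⟩
  obtain rfl : γ = gaussianMatrix n k := hγ
  have hγ_inv : ∀ U : Matrix (Fin n) (Fin n) ℝ, Uᵀ * U = 1 →
      (gaussianMatrix n k).map (fun A => U * A) = gaussianMatrix n k := fun U hU =>
    (measurePreserving_mul_left_gaussianMatrix hU).map_eq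
  have hsmul : orbitAverage (fun M => f ((alphaConst k n)⁻¹ • M)) =
      fun M => orbitAverage f ((alphaConst k n)⁻¹ • M) := by
    ext1 M
    simp only [orbitAverage, Matrix.mul_smul]
  have hinv := fun U (hU : Uᵀ * U = 1) => orbitAverage_mul f hU
  have hμ : ∀ᵐ Q ∂μ, orbitAverage f Q = orbitAverage f (inclusionMatrix hkn) := by
    filter_upwards [hμ_stiefel] with Q hQ
    obtain ⟨V, hV, rfl⟩ := exists_orthogonal_mul_inclusionMatrix hkn hQ
    exact hinv V hV _
  calc ∫ Q, f Q ∂μ = ∫ Q, orbitAverage f Q ∂μ :=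
        (integral_orbitAverage hμ_inv
          (hf.continuous_matrix.integrable_of_ae_transpose_mul_self hkn hμ_stiefel)).symm
    _ = orbitAverage f (inclusionMatrix hkn) := by
        rw [integral_congr_ae hμ]
        simp
    _ ≤ ∫ M, orbitAverage f ((alphaConst k n)⁻¹ • M) ∂gaussianMatrix n k := by
        refine map_inclusionMatrix_le_integral hkn (convexOn_orbitAverage hf) hinv ?_
        rw [← hsmul]
        exact integrable_orbitAverage hγ_inv hint
    _ = ∫ M, f ((alphaConst k n)⁻¹ • M) ∂gaussianMatrix n k := by
        rw [← hsmul]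
        exact integral_orbitAverage hγ_inv hint
end

section
/- For every real p ≥ 1/2, the ratio of gamma functions satisfies √(p − 1/2) < √2 · Γ((p+1)/2) / Γ(p/2) < √p. -/
open Filter Topology in
/-- A function with `h (x + 1) ≤ h x` and `1 - 1 / (x - a) ≤ h x` for all `x > a` is at least `1`
there. -/
theorem one_le_of_add_one_le {h : ℝ → ℝ} {a : ℝ}
    (hstep : ∀ x, a < x → h (x + 1) ≤ h x) (hbound : ∀ x, a < x → 1 - 1 / (x - a) ≤ h x)
    {x : ℝ} (hx : a < x) : 1 ≤ h x := by
  have hiter (n : ℕ) : h (x + n) ≤ h x := by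
    induction n with
    | zero => simp
    | succ n ih =>
      have hn : a < x + n := by have := n.cast_nonneg (α := ℝ); linarith
      push_cast
      rw [← add_assoc]
      exact (hstep _ hn).trans ih
  have hlim : Tendsto (fun n : ℕ => 1 - 1 / (x + n - a)) atTop (𝓝 (1 - 0)) := by
    refine tendsto_const_nhds.sub (tendsto_const_nhds.div_atTop ?_)
    have := tendsto_atTop_add_const_right atTop (x - a) (tendsto_natCast_atTop_atTop (R := ℝ))
    exact this.congr fun n => by ring
  rw [sub_zero] at hlim
  refine le_of_tendsto hlim (Eventually.of_forall fun n => (hbound _ ?_).trans (hiter n))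
  have := n.cast_nonneg (α := ℝ)
  linarith

theorem Real.Gamma_add_half_div_Gamma_pos {x : ℝ} (hx : 0 < x) :
    0 < Gamma (x + 1 / 2) / Gamma x :=
  div_pos (Gamma_pos_of_pos (by linarith)) (Gamma_pos_of_pos hx)

theorem Real.Gamma_add_half_div_Gamma_add_one {x : ℝ} (hx : 0 < x) :
    Gamma (x + 1 + 1 / 2) / Gamma (x + 1) =
      (x + 1 / 2) / x * (Gamma (x + 1 / 2) / Gamma x) := by
  rw [show x + 1 + 1 / 2 = x + 1 / 2 + 1 by ring, Gamma_add_one (by positivity),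
    Gamma_add_one hx.ne']
  exact mul_div_mul_comm _ _ _ _

theorem Real.sq_Gamma_add_half_div_Gamma_le {x : ℝ} (hx : 0 < x) :
    (Gamma (x + 1 / 2) / Gamma x) ^ 2 ≤ x := by
  have hG := Gamma_pos_of_pos hx
  have h := Gamma_mul_add_mul_le_rpow_Gamma_mul_rpow_Gamma hx (show 0 < x + 1 by linarith)
    (show (0 : ℝ) < 1 / 2 by norm_num) (show (0 : ℝ) < 1 / 2 by norm_num) (by norm_num)
  rw [show 1 / 2 * x + 1 / 2 * (x + 1) = x + 1 / 2 by ring, ← sqrt_eq_rpow, ← sqrt_eq_rpow,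
    Gamma_add_one hx.ne', ← sqrt_mul hG.le, show Gamma x * (x * Gamma x) = x * Gamma x ^ 2 by ring]
    at h
  rw [div_pow, div_le_iff₀ (by positivity)]
  exact (le_sqrt (Gamma_pos_of_pos (by positivity)).le (by positivity)).1 h

theorem Real.sq_Gamma_add_half_div_Gamma_lt {x : ℝ} (hx : 0 < x) :
    (Gamma (x + 1 / 2) / Gamma x) ^ 2 < x := by
  have h := sq_Gamma_add_half_div_Gamma_le (show 0 < x + 1 by linarith)
  rw [Gamma_add_half_div_Gamma_add_one hx, mul_pow, div_pow, div_mul_eq_mul_div,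
    div_le_iff₀ (by positivity)] at h
  refine lt_of_mul_lt_mul_left (h.trans_lt ?_) (sq_nonneg (x + 1 / 2))
  nlinarith

theorem Real.sub_half_le_sq_Gamma_add_half_div_Gamma {x : ℝ} (hx : 0 < x) :
    x - 1 / 2 ≤ (Gamma (x + 1 / 2) / Gamma x) ^ 2 := by
  have h := sq_Gamma_add_half_div_Gamma_le (show 0 < x + 1 / 2 by linarith)
  have hG := Gamma_pos_of_pos hx
  have hG' := Gamma_pos_of_pos (show 0 < x + 1 / 2 by linarith)
  rw [show x + 1 / 2 + 1 / 2 = x + 1 by ring, Gamma_add_one hx.ne', div_pow,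
    div_le_iff₀ (by positivity)] at h
  rw [div_pow, le_div_iff₀ (by positivity)]
  refine le_of_mul_le_mul_left ?_ (show 0 < x + 1 / 2 by linarith)
  nlinarith [sq_nonneg (Gamma x)]

theorem Real.sub_quarter_lt_sq_Gamma_add_half_div_Gamma {x : ℝ} (hx : 1 / 4 ≤ x) :
    x - 1 / 4 < (Gamma (x + 1 / 2) / Gamma x) ^ 2 := by
  have hpos : 0 < x := by linarith
  rcases hx.eq_or_lt with rfl | hx
  · simpa using pow_pos (Gamma_add_half_div_Gamma_pos hpos) 2
  set h : ℝ → ℝ := fun y => (Gamma (y + 1 / 2) / Gamma y) ^ 2 / (y - 1 / 4) with h_def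
  have hstep (y : ℝ) (hy : 1 / 4 < y) : h (y + 1) < h y := by
    have hy0 : 0 < y := by linarith
    have hr := pow_pos (Gamma_add_half_div_Gamma_pos hy0) 2
    simp only [h_def]
    rw [Gamma_add_half_div_Gamma_add_one hy0, mul_pow, div_lt_div_iff₀ (by linarith) (by linarith),
      div_pow, div_mul_eq_mul_div, div_mul_eq_mul_div, div_lt_iff₀ (by positivity)]
    nlinarith
  have hbound (y : ℝ) (hy : 1 / 4 < y) : 1 - 1 / (y - 1 / 4) ≤ h y := by
    have hy' : 0 < y - 1 / 4 := by linarith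
    rw [one_sub_div hy'.ne', div_le_div_iff_of_pos_right hy']
    linarith [sub_half_le_sq_Gamma_add_half_div_Gamma (show 0 < y by linarith)]
  have hone := one_le_of_add_one_le (fun y hy => (hstep y hy).le) hbound
    (show 1 / 4 < x + 1 by linarith)
  exact (one_lt_div (by linarith)).1 (hone.trans_lt (hstep x hx))

/-- **Gamma-ratio bounds.**  For every real `p ≥ 1/2`,
`√(p − 1/2) < √2 · Γ((p+1)/2) / Γ(p/2) < √p`. -/
theorem gamma_ratio_bounds (p : ℝ) (hp : (1 : ℝ) / 2 ≤ p) :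
    Real.sqrt (p - 1 / 2) < Real.sqrt 2 * Real.Gamma ((p + 1) / 2) / Real.Gamma (p / 2)
      ∧ Real.sqrt 2 * Real.Gamma ((p + 1) / 2) / Real.Gamma (p / 2) < Real.sqrt p := by
  have hpos : 0 < p / 2 := by linarith
  have hr := Real.Gamma_add_half_div_Gamma_pos hpos
  have hlower := Real.sub_quarter_lt_sq_Gamma_add_half_div_Gamma (show 1 / 4 ≤ p / 2 by linarith)
  have hupper := Real.sq_Gamma_add_half_div_Gamma_lt hpos
  rw [add_div, mul_div_assoc]
  refine ⟨(Real.sqrt_lt' (by positivity)).2 ?_, (Real.lt_sqrt (by positivity)).2 ?_⟩ <;>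
  · rw [mul_pow, Real.sq_sqrt zero_le_two]
    linarith
end

section
/- For every ρ ∈ (0, 1], one has 1.5 · ρ / (1 − (1 − ρ)^{3/2}) ≤ 1 + ρ/2. Equivalently, the function ρ ↦ ρ/(1 − (1 − ρ)^{3/2}) is bounded above on (0,1] by the chord ρ ↦ (2 + ρ)/3 joining its endpoint limits. -/
/-- **A chord bound.**  For every `ρ ∈ (0, 1]`,
`1.5 · ρ / (1 − (1 − ρ)^{3/2}) ≤ 1 + ρ/2`; equivalently, `ρ ↦ ρ/(1 − (1 − ρ)^{3/2})` is
bounded above on `(0,1]` by the chord `ρ ↦ (2 + ρ)/3`. -/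
theorem chord_bound (ρ : ℝ) (hρ0 : 0 < ρ) (hρ1 : ρ ≤ 1) :
    1.5 * ρ / (1 - (1 - ρ) ^ ((3 : ℝ) / 2)) ≤ 1 + ρ / 2
      ∧ ρ / (1 - (1 - ρ) ^ ((3 : ℝ) / 2)) ≤ (2 + ρ) / 3 := by
  have h0 : 0 ≤ 1 - ρ := by linarith
  obtain ⟨s, hs, hs0⟩ : ∃ s : ℝ, s = √(1 - ρ) ∧ 0 ≤ s := ⟨_, rfl, Real.sqrt_nonneg _⟩
  have hsq : s ^ 2 = 1 - ρ := by rw [hs, Real.sq_sqrt h0]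
  have hpow : (1 - ρ) ^ ((3 : ℝ) / 2) = s ^ 3 := by
    rw [← hsq, ← Real.rpow_natCast s 2, ← Real.rpow_mul hs0, ← Real.rpow_natCast s 3]
    norm_num
  have hs1 : s < 1 := by nlinarith
  have hpos : 0 < 1 - s ^ 3 := sub_pos.2 (pow_lt_one₀ hs0 hs1 three_ne_zero)
  have hρ : ρ = 1 - s ^ 2 := by linarith
  have key : 0 ≤ s ^ 2 * (1 - s) ^ 2 * (2 + s) := by positivity
  rw [hpow, div_le_iff₀ hpos, div_le_iff₀ hpos, hρ]
  constructor <;> linarith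
end
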